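/- Let A be a commutative ring and let M be a finitely generated projective module over the polynomial ring A[t]. If the base change M ⊗_{A[t]} A[t, t⁻¹] is a free A[t, t⁻¹]-module and the base change M ⊗_{A[t]} A⟦t⟧ is a free A⟦t⟧-module, then M is a free A[t]-module. -/

import Mathlib

open TensorProduct

open Polynomial

open scoped LaurentPolynomial

namespace LaurentPolynomial

section Coefficients

variable {R : Type*} [CommRing R]

theorem coeff_mul_eq_sum (p q : R[T;T⁻¹]) (n : ℤ) :
    (p * q).coeff n = ∑ i ∈ p.coeff.support, p.coeff i * q.coeff (n - i) := by
  classical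
  rw [AddMonoidAlgebra.coeff_mul, Finsupp.sum]
  refine Finset.sum_congr rfl fun i _ => ?_
  rw [Finsupp.sum, Finset.sum_eq_single (n - i)]
  · simp
  · intro j _ hj
    rw [if_neg]
    omega
  · intro h
    simp [Finsupp.notMem_support_iff.mp h]

theorem coeff_mul_T (p : R[T;T⁻¹]) (m n : ℤ) : (p * T m).coeff n = p.coeff (n - m) := by
  rw [T, AddMonoidAlgebra.coeff_mul_single_eq_coeff_mul (n - m), mul_one]
  intro i _
  omega

theorem coeff_C_mul (a : R) (p : R[T;T⁻¹]) (n : ℤ) : (C a * p).coeff n = a * p.coeff n := by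
  rw [← smul_eq_C_mul, AddMonoidAlgebra.coeff_smul_apply, smul_eq_mul]

theorem coeff_toLaurent_natCast (f : R[X]) (n : ℕ) : (toLaurent f).coeff n = f.coeff n := by
  rw [coeff_toLaurent]
  exact Finsupp.mapDomain_apply Nat.cast_injective _ _

theorem coeff_toLaurent_of_neg (f : R[X]) {n : ℤ} (hn : n < 0) : (toLaurent f).coeff n = 0 := by
  rw [coeff_toLaurent]
  refine Finsupp.mapDomain_of_notMem_range _ _ ?_
  rintro ⟨k, rfl⟩
  simp at hn
  omega

/-- The part of a Laurent polynomial of degree at least `n`. -/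
noncomputable def highPart (n : ℤ) (p : R[T;T⁻¹]) : R[T;T⁻¹] :=
  .ofCoeff (p.coeff.filter (n ≤ ·))

theorem coeff_highPart (n : ℤ) (p : R[T;T⁻¹]) (i : ℤ) :
    (highPart n p).coeff i = if n ≤ i then p.coeff i else 0 := by
  simp [highPart, Finsupp.filter_apply]

theorem exists_toLaurent_eq {p : R[T;T⁻¹]} (hp : ∀ i < 0, p.coeff i = 0) :
    ∃ f : R[X], toLaurent f = p := by
  obtain ⟨n, f, hf⟩ := exists_T_pow p
  have hfn : X ^ n ∣ f := by
    rw [X_pow_dvd_iff]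
    intro d hd
    rw [← coeff_toLaurent_natCast, hf, coeff_mul_T]
    exact hp _ (by omega)
  obtain ⟨g, rfl⟩ := hfn
  refine ⟨g, ?_⟩
  rw [map_mul, toLaurent_X_pow, T_mul] at hf
  exact (isUnit_T (n : ℤ)).mul_right_cancel hf

theorem coeff_mul_mem_of_lt {I : Ideal R} {p q : R[T;T⁻¹]} {a b : ℤ}
    (hp : ∀ i < a, p.coeff i ∈ I) (hq : ∀ i < b, q.coeff i ∈ I) :
    ∀ i < a + b, (p * q).coeff i ∈ I := by
  intro n hn
  rw [coeff_mul_eq_sum]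
  refine Ideal.sum_mem _ fun i _ => ?_
  by_cases hi : i < a
  · exact I.mul_mem_right _ (hp i hi)
  · exact I.mul_mem_left _ (hq _ (by omega))

theorem coeff_mul_sub_mem {I : Ideal R} {p q : R[T;T⁻¹]} {a b : ℤ}
    (hp : ∀ i < a, p.coeff i ∈ I) (hq : ∀ i < b, q.coeff i ∈ I) :
    (p * q).coeff (a + b) - p.coeff a * q.coeff b ∈ I := by
  have hsplit : p * q = C (p.coeff a) * q * T a + (p - C (p.coeff a) * T a) * q := by ring
  have hp' : ∀ i < a + 1, (p - C (p.coeff a) * T a).coeff i ∈ I := by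
    intro i hi
    rw [AddMonoidAlgebra.coeff_sub, Finsupp.sub_apply, coeff_C_mul, T_apply]
    split_ifs with h
    · subst h; simp
    · simpa using hp i (by omega)
  have h := coeff_mul_mem_of_lt hp' hq (a + b) (by omega)
  rw [hsplit, AddMonoidAlgebra.coeff_add, Finsupp.add_apply, coeff_mul_T, coeff_C_mul]
  simpa using h

theorem coeff_mul_eq_zero_of_gt {p q : R[T;T⁻¹]} {a b : ℤ}
    (hp : ∀ i > a, p.coeff i = 0) (hq : ∀ i > b, q.coeff i = 0) :
    ∀ i > a + b, (p * q).coeff i = 0 := by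
  intro n hn
  rw [coeff_mul_eq_sum]
  refine Finset.sum_eq_zero fun i _ => ?_
  by_cases hi : a < i
  · rw [hp i hi, zero_mul]
  · rw [hq _ (by omega), mul_zero]

/-- The Laurent polynomials whose reduction modulo `I` is a polynomial. -/
def polynomialMod (I : Ideal R) : Subring R[T;T⁻¹] where
  carrier := {p | ∀ i < 0, p.coeff i ∈ I}
  zero_mem' := by simp
  one_mem' := by
    intro i hi
    rw [← T_zero, T_apply, if_neg hi.ne']
    exact I.zero_mem
  add_mem' := fun hp hq i hi => I.add_mem (hp i hi) (hq i hi)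
  neg_mem' := fun hp i hi => I.neg_mem (hp i hi)
  mul_mem' := fun hp hq => coeff_mul_mem_of_lt hp hq

theorem toLaurent_mem_polynomialMod (I : Ideal R) (f : R[X]) :
    toLaurent f ∈ polynomialMod I := fun i hi => by
  rw [coeff_toLaurent_of_neg f hi]
  exact I.zero_mem

theorem coeff_sum_apply {ι : Type*} (s : Finset ι) (f : ι → R[T;T⁻¹]) (n : ℤ) :
    (∑ i ∈ s, f i).coeff n = ∑ i ∈ s, (f i).coeff n := by
  rw [AddMonoidAlgebra.coeff_sum, Finsupp.finsetSum_apply]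

theorem eq_sum_coeff_smul_T (p : R[T;T⁻¹]) : p = ∑ i ∈ p.coeff.support, p.coeff i • T i := by
  ext n
  rw [coeff_sum_apply]
  simp

end Coefficients

end LaurentPolynomial

namespace LaurentPolynomial

section Patching

variable {A : Type*} [CommRing A] {ι κ : Type*} [Fintype κ]

theorem map_toLaurent_injective {m n : Type*} :
    Function.Injective fun P : Matrix m n A[X] => P.map toLaurent :=
  Matrix.map_injective toLaurent_injective

/-- The `A[t]`-span of the columns of `V`, as an `A`-module. -/
noncomputable def columnSpan (V : Matrix ι κ A[T;T⁻¹]) : Submodule A (ι → A[T;T⁻¹]) :=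
  LinearMap.range
    (V.mulVecLin.restrictScalars A ∘ₗ (toLaurentAlg (R := A)).toLinearMap.compLeft κ)

theorem mem_columnSpan {V : Matrix ι κ A[T;T⁻¹]} {w : ι → A[T;T⁻¹]} :
    w ∈ columnSpan V ↔ ∃ c : κ → A[X], V.mulVec (fun a => toLaurent (c a)) = w := Iff.rfl

variable (A ι) in
/-- The vectors of Laurent polynomials all of whose terms have negative degree. -/
def negativePart : Submodule A (ι → A[T;T⁻¹]) where
  carrier := {y | ∀ i, ∀ j ≥ 0, (y i).coeff j = 0}
  zero_mem' := by simp
  add_mem' := fun hx hy i j hj => by simp [hx i j hj, hy i j hj]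
  smul_mem' := fun a x hx i j hj => by simp [hx i j hj]

theorem mem_negativePart {y : ι → A[T;T⁻¹]} :
    y ∈ negativePart A ι ↔ ∀ i, ∀ j ≥ 0, (y i).coeff j = 0 := Iff.rfl

theorem mulVec_mem_smul_top {I : Ideal A} (V : Matrix ι κ A[T;T⁻¹]) {u : κ → A[T;T⁻¹]}
    (hu : ∀ a n, (u a).coeff n ∈ I) :
    V.mulVec u ∈ I • (⊤ : Submodule A (ι → A[T;T⁻¹])) := by
  rw [Matrix.mulVec_eq_sum]
  refine Submodule.sum_mem _ fun a _ => ?_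
  rw [op_smul_eq_smul, eq_sum_coeff_smul_T (u a), Finset.sum_smul]
  refine Submodule.sum_mem _ fun n _ => ?_
  rw [smul_assoc]
  exact Submodule.smul_mem_smul (hu a n) trivial

variable [Fintype ι]

theorem exists_forall_coeff_eq_zero_of_lt {m n : Type*} [Finite m] [Finite n]
    (U : Matrix m n A[T;T⁻¹]) : ∃ K : ℕ, ∀ a b, ∀ i < -(K : ℤ), (U a b).coeff i = 0 := by
  classical
  cases nonempty_fintype m
  cases nonempty_fintype n
  refine ⟨Finset.univ.sup fun x : m × n => (U x.1 x.2).coeff.support.sup Int.natAbs, ?_⟩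
  intro a b i hi
  by_contra h
  have h1 : i.natAbs ≤ (U a b).coeff.support.sup Int.natAbs :=
    Finset.le_sup (f := Int.natAbs) (Finsupp.mem_support_iff.mpr h)
  have h2 := Finset.le_sup (f := fun x : m × n => (U x.1 x.2).coeff.support.sup Int.natAbs)
    (Finset.mem_univ (a, b))
  dsimp only at h2
  omega

theorem mem_of_forall_single_T_mem [DecidableEq ι] {P : Submodule A (ι → A[T;T⁻¹])}
    (h : ∀ i n, (Pi.single i (T n) : ι → A[T;T⁻¹]) ∈ P) (w : ι → A[T;T⁻¹]) : w ∈ P := by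
  rw [← Finset.univ_sum_single w]
  refine P.sum_mem fun i _ => ?_
  rw [eq_sum_coeff_smul_T (w i), ← LinearMap.coe_single A, map_sum]
  refine P.sum_mem fun n _ => ?_
  rw [map_smul]
  exact P.smul_mem _ (h i n)

theorem columnSpan_sup_negativePart [DecidableEq ι] {I : Ideal A} (hI : I ≤ Ideal.jacobson ⊥)
    {V : Matrix ι κ A[T;T⁻¹]} {U : Matrix κ ι A[T;T⁻¹]} (hVU : V * U = 1)
    (hU : ∀ a i, U a i ∈ polynomialMod I) :
    columnSpan V ⊔ negativePart A ι = ⊤ := by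
  obtain ⟨K, hK⟩ := exists_forall_coeff_eq_zero_of_lt U
  set N := columnSpan V ⊔ negativePart A ι
  let N' : Submodule A (ι → A[T;T⁻¹]) :=
    Submodule.span A (Set.range fun x : ι × Fin K => Pi.single x.1 (T (x.2 : ℤ)))
  have hsingle : ∀ i j, (Pi.single i (T j) : ι → A[T;T⁻¹]) =
      V.mulVec (fun a => U a i * T j) := by
    intro i j
    have : (fun a => U a i * T j) = U.mulVec (Pi.single i (T j)) := by
      ext1 a
      simp [Matrix.mulVec_single]
    rw [this, Matrix.mulVec_mulVec, hVU, Matrix.one_mulVec]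
  have hneg : ∀ i, ∀ j < 0, (Pi.single i (T j) : ι → A[T;T⁻¹]) ∈ N := by
    intro i j hj
    refine Submodule.mem_sup_right (mem_negativePart.mpr fun i' n hn => ?_)
    by_cases h : i' = i
    · subst h
      rw [Pi.single_eq_same, T_apply, if_neg (by omega)]
    · rw [Pi.single_eq_of_ne h]
      simp
  have htop : ⊤ ≤ N ⊔ N' := by
    refine fun w _ => mem_of_forall_single_T_mem (fun i n => ?_) w
    rcases lt_or_ge n 0 with hn | hn
    · exact Submodule.mem_sup_left (hneg i n hn)
    rcases lt_or_ge n K with hnK | hnK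
    · refine Submodule.mem_sup_right (Submodule.subset_span ⟨(i, ⟨n.toNat, by omega⟩), ?_⟩)
      simp [hn]
    · refine Submodule.mem_sup_left (Submodule.mem_sup_left (mem_columnSpan.mpr ?_))
      have hpoly : ∀ a, ∃ f : A[X], toLaurent f = U a i * T n := fun a =>
        exists_toLaurent_eq fun m hm => by
          rw [coeff_mul_T]
          exact hK a i _ (by omega)
      choose c hc using hpoly
      exact ⟨c, by simp_rw [hc]; exact (hsingle i n).symm⟩
  have hmod : ⊤ ≤ N ⊔ I • (⊤ : Submodule A (ι → A[T;T⁻¹])) := by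
    refine fun w _ => mem_of_forall_single_T_mem (fun i n => ?_) w
    rcases lt_or_ge n 0 with hn | hn
    · exact Submodule.mem_sup_left (hneg i n hn)
    have hpoly : ∀ a, ∃ f : A[X], toLaurent f = highPart 0 (U a i * T n) := fun a =>
      exists_toLaurent_eq fun m hm => by
        rw [coeff_highPart, if_neg (by omega)]
    choose c hc using hpoly
    have hdecomp : (fun a => U a i * T n) = (fun a => toLaurent (c a)) +
        fun a => U a i * T n - highPart 0 (U a i * T n) := by
      ext1 a
      simp [hc]
    rw [hsingle, hdecomp, Matrix.mulVec_add]
    refine Submodule.add_mem_sup (Submodule.mem_sup_left (mem_columnSpan.mpr ⟨c, rfl⟩))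
      (mulVec_mem_smul_top V fun a m => ?_)
    rw [AddMonoidAlgebra.coeff_sub, Finsupp.sub_apply, coeff_highPart, coeff_mul_T]
    split_ifs with hm
    · simp
    · simpa using hU a i (m - n) (by omega)
  have hle : N' ≤ N := by
    refine Submodule.le_of_le_smul_of_le_jacobson_bot
      (Submodule.fg_span (Set.finite_range _)) hI (le_top.trans (hmod.trans ?_))
    refine sup_le le_sup_left ((Submodule.smul_mono le_rfl htop).trans ?_)
    rw [Submodule.smul_sup]
    exact sup_le_sup_right Submodule.smul_le_right _
  exact top_le_iff.mp (htop.trans (sup_le le_rfl hle))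

/-- The residue pairing shows that the column span of `V` meets the vectors of negative degree
trivially as soon as its dual lattice satisfies the conclusion of
`columnSpan_sup_negativePart`. -/
theorem eq_zero_of_mem_columnSpan_of_mem_negativePart [DecidableEq ι]
    {V : Matrix ι κ A[T;T⁻¹]} {U : Matrix κ ι A[T;T⁻¹]} {E : Matrix κ κ A[X]}
    (hUV : U * V = E.map toLaurent)
    (hdual : columnSpan U.transpose ⊔ negativePart A ι = ⊤)
    {x : ι → A[T;T⁻¹]} (hx : x ∈ columnSpan V) (hx' : x ∈ negativePart A ι) : x = 0 := by
  obtain ⟨c, rfl⟩ := mem_columnSpan.mp hx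
  set x := V.mulVec fun a => toLaurent (c a)
  have hres : ∀ w : ι → A[T;T⁻¹], (w ⬝ᵥ x).coeff (-1) = 0 := by
    intro w
    obtain ⟨v, hv, y, hy, rfl⟩ := Submodule.mem_sup.mp (hdual ▸ Submodule.mem_top : w ∈ _)
    obtain ⟨r, rfl⟩ := mem_columnSpan.mp hv
    have h1 : (U.transpose.mulVec fun a => toLaurent (r a)) ⬝ᵥ x =
        toLaurent (r ⬝ᵥ E.mulVec c) := by
      rw [Matrix.mulVec_transpose, ← Matrix.dotProduct_mulVec, Matrix.mulVec_mulVec, hUV]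
      simp [dotProduct, Matrix.mulVec, map_sum]
    rw [add_dotProduct, h1, AddMonoidAlgebra.coeff_add, Finsupp.add_apply,
      coeff_toLaurent_of_neg _ (by omega), zero_add, dotProduct, coeff_sum_apply]
    refine Finset.sum_eq_zero fun i _ => ?_
    exact coeff_mul_eq_zero_of_gt (a := -1) (b := -1) (fun j hj => hy i j (by omega))
      (fun j hj => hx' i j (by omega)) _ (by omega)
  ext i n
  have := hres (Pi.single i (T (-1 - n)))
  rw [single_dotProduct, T_mul, coeff_mul_T] at this
  simpa using this

end Patching

end LaurentPolynomial

namespace LaurentPolynomial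

section Factorization

variable {A : Type*} [CommRing A] {ι κ : Type*} [Fintype ι] [Fintype κ]

theorem map_toLaurent_mulVec {m n : Type*} [Fintype n] (P : Matrix m n A[X]) (d : n → A[X]) :
    (P.map toLaurent).mulVec (fun i => toLaurent (d i)) = fun a => toLaurent (P.mulVec d a) := by
  ext1 a
  simp [Matrix.mulVec, dotProduct, map_sum]

theorem mulVec_coeff_eq_zero_of_gt {Y : Matrix ι ι A[T;T⁻¹]}
    (hY : ∀ i l, ∀ j ≥ 0, (Y i l).coeff j = 0) {d : ι → A[T;T⁻¹]} {N : ℤ}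
    (hd : ∀ i, ∀ j > N, (d i).coeff j = 0) (i : ι) (j : ℤ) (hj : j ≥ N) :
    (Y.mulVec d i).coeff j = 0 := by
  rw [Matrix.mulVec, dotProduct, coeff_sum_apply]
  refine Finset.sum_eq_zero fun l _ => ?_
  exact coeff_mul_eq_zero_of_gt (a := -1) (b := N) (fun k hk => hY i l k (by omega)) (hd l) _
    (by omega)

variable [DecidableEq ι]

/-- If `A[t, t⁻¹]ⁿ` is the direct sum of the column span of `V` and the vectors of negative
degree, then the column span is free over `A[t]`. -/
theorem exists_factorization_of_isCompl {V : Matrix ι κ A[T;T⁻¹]} {U : Matrix κ ι A[T;T⁻¹]}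
    {E : Matrix κ κ A[X]} (hUV : U * V = E.map toLaurent) (hVU : V * U = 1)
    (h : IsCompl (columnSpan V) (negativePart A ι)) :
    ∃ (P : Matrix κ ι A[X]) (Q : Matrix ι κ A[X]), P * Q = E ∧ Q * P = 1 := by
  classical
  have hgen : ∀ i, ∃ c : κ → A[X], ∃ y ∈ negativePart A ι,
      (V.mulVec fun a => toLaurent (c a)) + y = Pi.single i 1 := by
    intro i
    obtain ⟨v, hv, y, hy, hvy⟩ := Submodule.mem_sup.mp
      (h.sup_eq_top ▸ Submodule.mem_top : (Pi.single i 1 : ι → A[T;T⁻¹]) ∈ _)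
    obtain ⟨c, rfl⟩ := mem_columnSpan.mp hv
    exact ⟨c, y, hy, hvy⟩
  choose c y hy hcy using hgen
  let C' : Matrix κ ι A[X] := Matrix.of fun a i => c i a
  let Y : Matrix ι ι A[T;T⁻¹] := Matrix.of fun l i => y i l
  have hY : ∀ i l, ∀ j ≥ 0, (Y i l).coeff j = 0 := fun i l j hj => hy l i j hj
  set G : Matrix ι ι A[T;T⁻¹] := V * C'.map toLaurent with hG
  have hGY : G = 1 - Y := by
    rw [eq_sub_iff_add_eq]
    ext1 l i
    have := congrFun (hcy i) l
    simpa [G, C', Y, Matrix.mul_apply, Matrix.mulVec, dotProduct, Matrix.one_apply,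
      Pi.single_apply] using this
  have hGmul : ∀ d : ι → A[T;T⁻¹], G.mulVec d = d - Y.mulVec d := by
    intro d
    rw [hGY, Matrix.sub_mulVec, Matrix.one_mulVec]
  have hGspan : ∀ d : ι → A[X], G.mulVec (fun i => toLaurent (d i)) ∈ columnSpan V := by
    intro d
    rw [hG, ← Matrix.mulVec_mulVec, map_toLaurent_mulVec]
    exact mem_columnSpan.mpr ⟨_, rfl⟩
  have hexists : ∀ N : ℕ, ∀ x ∈ columnSpan V, (∀ i, ∀ j ≥ (N : ℤ), (x i).coeff j = 0) →
      ∃ d : ι → A[X], G.mulVec (fun i => toLaurent (d i)) = x := by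
    intro N
    induction N with
    | zero =>
      intro x hx hxN
      have hx0 : x = 0 := by
        have : x ∈ columnSpan V ⊓ negativePart A ι := ⟨hx, hxN⟩
        rwa [h.inf_eq_bot, Submodule.mem_bot] at this
      refine ⟨0, ?_⟩
      rw [hx0]
      convert G.mulVec_zero
      simp
    | succ N ih =>
      intro x hx hxN
      let d₀ : ι → A[X] := fun i => Polynomial.C ((x i).coeff N) * X ^ N
      have hd₀ : ∀ i j, (toLaurent (d₀ i)).coeff j = if j = N then (x i).coeff N else 0 := by
        intro i j
        simp only [d₀, map_mul, toLaurent_C, toLaurent_X_pow, coeff_C_mul,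
          T_apply, eq_comm (a := (N : ℤ))]
        split_ifs <;> simp
      obtain ⟨d, hd⟩ := ih (x - G.mulVec fun i => toLaurent (d₀ i))
        ((columnSpan V).sub_mem hx (hGspan d₀)) (by
          intro i j hj
          rw [hGmul]
          have h1 := mulVec_coeff_eq_zero_of_gt hY (d := fun i => toLaurent (d₀ i)) (N := N)
            (fun i j hj => by rw [hd₀, if_neg (by omega)]) i j hj
          simp only [Pi.sub_apply, AddMonoidAlgebra.coeff_sub, Finsupp.sub_apply, h1, hd₀]
          split_ifs with hjN
          · simp [hjN]
          · simp [hxN i j (by push_cast; omega)])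
      refine ⟨d + d₀, ?_⟩
      have : (fun i => toLaurent ((d + d₀) i)) =
          (fun i => toLaurent (d i)) + fun i => toLaurent (d₀ i) := by
        ext1 i
        simp
      rw [this, Matrix.mulVec_add, hd, sub_add_cancel]
  have hunique : ∀ N : ℕ, ∀ d : ι → A[X], (∀ i, ∀ j ≥ N, (d i).coeff j = 0) →
      (G.mulVec fun i => toLaurent (d i)) = 0 → d = 0 := by
    intro N
    induction N with
    | zero => exact fun d hd _ => by ext i j; exact hd i j (Nat.zero_le j)
    | succ N ih =>
      intro d hd hGd
      refine ih d (fun i j hj => ?_) hGd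
      rw [hGmul, sub_eq_zero] at hGd
      have hdi := congrFun hGd i
      rw [← coeff_toLaurent_natCast, hdi]
      refine mulVec_coeff_eq_zero_of_gt hY (N := N) (fun l k hk => ?_) i j (by omega)
      obtain ⟨k, rfl⟩ := Int.eq_ofNat_of_zero_le (show 0 ≤ k by omega)
      rw [coeff_toLaurent_natCast]
      exact hd l k (by omega)
  have hzero : ∀ D : Matrix ι ι A[X], G * D.map toLaurent = 0 → D = 0 := by
    intro D hD
    refine Matrix.ext_col fun i => ?_
    refine hunique (Finset.univ.sup fun l => (D l i).natDegree + 1) (D.col i) (fun l j hj => ?_) ?_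
    · refine coeff_eq_zero_of_natDegree_lt (lt_of_lt_of_le (Nat.lt_succ_self _) (le_trans ?_ hj))
      exact Finset.le_sup (f := fun l => (D l i).natDegree + 1) (Finset.mem_univ l)
    · ext1 k
      exact congrFun (congrFun hD k) i
  have hcol : ∀ a, ∃ d : ι → A[X], G.mulVec (fun i => toLaurent (d i)) = V.col a := by
    intro a
    have hsingle : (fun b => toLaurent ((Pi.single a 1 : κ → A[X]) b)) = Pi.single a 1 := by
      ext1 b
      by_cases hb : b = a
      · subst hb
        simp
      · simp [hb]
    have hmem : V.col a ∈ columnSpan V :=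
      mem_columnSpan.mpr ⟨Pi.single a 1, by rw [hsingle, Matrix.mulVec_single_one]⟩
    obtain ⟨K, hK⟩ := exists_forall_coeff_eq_zero_of_lt (V.map invert)
    refine hexists (K + 1) _ hmem fun i j hj => ?_
    simpa using hK i a (-j) (by push_cast at hj; omega)
  choose d hd using hcol
  let D : Matrix ι κ A[X] := Matrix.of fun i a => d a i
  have hGD : G * D.map toLaurent = V := by
    ext1 i a
    exact congrFun (hd a) i
  have hGC : G * (D * (E * C')).map toLaurent = G := by
    rw [Matrix.map_mul, ← Matrix.mul_assoc, hGD, Matrix.map_mul, ← hUV, Matrix.mul_assoc,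
      ← Matrix.mul_assoc, hVU, Matrix.one_mul]
  refine ⟨E * C', D, map_toLaurent_injective ?_, ?_⟩
  · simp only [Matrix.map_mul]
    rw [← hUV, Matrix.mul_assoc, Matrix.mul_assoc, ← Matrix.mul_assoc V, hGD]
  · refine sub_eq_zero.mp (hzero _ ?_)
    rw [Matrix.map_sub _ (map_sub _), Matrix.mul_sub, hGC, Matrix.map_one _ (map_zero _)
      (map_one _), Matrix.mul_one, sub_self]

end Factorization

end LaurentPolynomial

namespace LaurentPolynomial

section Local

open IsLocalRing

variable {A : Type*} [CommRing A] {ι κ : Type*} [Fintype ι]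

theorem forall_mem_polynomialMod_of_mul_eq {I : Ideal A}
    {V : Matrix ι κ A[T;T⁻¹]} {U : Matrix κ ι A[T;T⁻¹]} {E : Matrix κ κ A[X]}
    (hUV : U * V = E.map toLaurent) (hV : ∀ i a, V i a ∈ polynomialMod I)
    (hrow : ∀ u : ι → A, (∀ a, ∑ i, u i * (V i a).coeff 0 ∈ I) → ∀ i, u i ∈ I)
    (N : ℕ) (hN : ∀ a i, ∀ n < -(N : ℤ), (U a i).coeff n ∈ I) :
    ∀ a i, U a i ∈ polynomialMod I := by
  induction N with
  | zero => exact fun a i n hn => hN a i n (by omega)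
  | succ N ih =>
    refine ih fun a i n hn => ?_
    rcases eq_or_ne n (-((N : ℤ) + 1)) with rfl | hne
    · refine hrow (fun i => (U a i).coeff (-((N : ℤ) + 1))) (fun b => ?_) i
      have h0 : ((U * V) a b).coeff (-((N : ℤ) + 1) + 0) = 0 := by
        rw [hUV, Matrix.map_apply, coeff_toLaurent_of_neg _ (by omega)]
      have h1 : ∑ i, ((U a i * V i b).coeff (-((N : ℤ) + 1) + 0) -
          (U a i).coeff (-((N : ℤ) + 1)) * (V i b).coeff 0) ∈ I :=
        Ideal.sum_mem _ fun i _ => coeff_mul_sub_mem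
          (fun n hn => hN a i n (by push_cast; omega)) (hV i b)
      rw [Finset.sum_sub_distrib, ← coeff_sum_apply, ← Matrix.mul_apply, h0, zero_sub] at h1
      exact neg_mem_iff.mp h1
    · exact hN a i n (by push_cast; omega)

variable [DecidableEq ι]

/-- The elementary modification replacing the row `i₀` by `t⁻¹` times a combination of rows
whose constant terms vanish modulo `I`. -/
theorem exists_modification {I : Ideal A} {V : Matrix ι κ A[T;T⁻¹]}
    (hV : ∀ i a, V i a ∈ polynomialMod I) {c : ι → A} {i₀ : ι} (hc : c i₀ = 1)
    (hcV : ∀ a, ∑ i, c i * (V i a).coeff 0 ∈ I) :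
    ∃ g : Matrix ι ι A[T;T⁻¹], g.det = T (-1) ∧ ∀ i a, (g * V) i a ∈ polynomialMod I := by
  refine ⟨Matrix.updateRow 1 i₀ fun i => T (-1) * C (c i), ?_, fun i a => ?_⟩
  · rw [← Matrix.cramer_transpose_apply, Matrix.transpose_one, Matrix.cramer_one]
    simp [hc]
  · rw [Matrix.updateRow_mul, Matrix.one_mul]
    by_cases hi : i = i₀
    · subst hi
      rw [Matrix.updateRow_self]
      have : Matrix.vecMul (fun i => T (-1) * C (c i)) V a = (∑ i, C (c i) * V i a) * T (-1) := by
        rw [Matrix.vecMul, dotProduct, Finset.sum_mul]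
        exact Finset.sum_congr rfl fun i _ => by ring
      rw [this]
      intro n hn
      rw [coeff_mul_T, coeff_sum_apply]
      simp_rw [coeff_C_mul]
      rcases eq_or_ne n (-1) with rfl | hne
      · simpa using hcV a
      · exact Ideal.sum_mem _ fun i _ => I.mul_mem_left _ (hV i a _ (by omega))
    · rw [Matrix.updateRow_ne hi]
      exact hV i a

variable [Fintype κ] [IsLocalRing A]

theorem exists_polynomialMod_of_det_eq (E : Matrix κ κ A[X]) (C' : Matrix κ ι A[X]) (d : ℕ) :
    ∀ (V : Matrix ι κ A[T;T⁻¹]) (U : Matrix κ ι A[T;T⁻¹]), U * V = E.map toLaurent → V * U = 1 →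
      (∀ i a, V i a ∈ polynomialMod (maximalIdeal A)) →
      (V * C'.map toLaurent).det = T (d : ℤ) →
      ∃ (V' : Matrix ι κ A[T;T⁻¹]) (U' : Matrix κ ι A[T;T⁻¹]), U' * V' = E.map toLaurent ∧
        V' * U' = 1 ∧ (∀ i a, V' i a ∈ polynomialMod (maximalIdeal A)) ∧
        ∀ a i, U' a i ∈ polynomialMod (maximalIdeal A) := by
  have hstep : ∀ (d : ℤ) (V : Matrix ι κ A[T;T⁻¹]) (U : Matrix κ ι A[T;T⁻¹]),
      U * V = E.map toLaurent → V * U = 1 →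
      (∀ i a, V i a ∈ polynomialMod (maximalIdeal A)) →
      (V * C'.map toLaurent).det = T d →
      (∀ a i, U a i ∈ polynomialMod (maximalIdeal A)) ∨
      ∃ (V' : Matrix ι κ A[T;T⁻¹]) (U' : Matrix κ ι A[T;T⁻¹]), U' * V' = E.map toLaurent ∧
        V' * U' = 1 ∧ (∀ i a, V' i a ∈ polynomialMod (maximalIdeal A)) ∧
        (V' * C'.map toLaurent).det = T (d - 1) := by
    intro d V U hUV hVU hV hdet
    by_cases hrow : ∀ u : ι → A, (∀ a, ∑ i, u i * (V i a).coeff 0 ∈ maximalIdeal A) →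
        ∀ i, u i ∈ maximalIdeal A
    · obtain ⟨K, hK⟩ := exists_forall_coeff_eq_zero_of_lt U
      refine .inl (forall_mem_polynomialMod_of_mul_eq hUV hV hrow K fun a i n hn => ?_)
      rw [hK a i n hn]
      exact zero_mem _
    · push Not at hrow
      obtain ⟨u, hu, i₀, hi₀⟩ := hrow
      obtain ⟨v, hv⟩ := (IsLocalRing.notMem_maximalIdeal.mp hi₀).exists_left_inv
      obtain ⟨g, hg, hgV⟩ := exists_modification hV (c := fun i => v * u i) (i₀ := i₀) hv
        fun a => by
          simp_rw [mul_assoc, ← Finset.mul_sum]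
          exact Ideal.mul_mem_left _ _ (hu a)
      have hgu : IsUnit g.det := hg ▸ isUnit_T (-1)
      refine .inr ⟨g * V, U * g⁻¹, ?_, ?_, hgV, ?_⟩
      · rw [Matrix.mul_assoc, Matrix.nonsing_inv_mul_cancel_left _ _ hgu, hUV]
      · rw [Matrix.mul_assoc, ← Matrix.mul_assoc V, hVU, Matrix.one_mul,
          Matrix.mul_nonsing_inv _ hgu]
      · rw [Matrix.mul_assoc, Matrix.det_mul, hg, hdet, ← T_add]
        ring_nf
  induction d with
  | zero =>
    intro V U hUV hVU hV hdet
    rcases hstep _ V U hUV hVU hV hdet with hU | ⟨V', U', -, -, hV', hdet'⟩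
    · exact ⟨V, U, hUV, hVU, hV, hU⟩
    · exfalso
      have hmem : (V' * C'.map toLaurent).det ∈ polynomialMod (maximalIdeal A) := by
        rw [Matrix.det_apply]
        refine sum_mem fun σ _ => zsmul_mem (prod_mem fun i _ => ?_) _
        rw [Matrix.mul_apply]
        exact sum_mem fun a _ => mul_mem (hV' _ _) (toLaurent_mem_polynomialMod _ _)
      rw [hdet'] at hmem
      have := hmem (-1) (by omega)
      simp at this
  | succ d ih =>
    intro V U hUV hVU hV hdet
    rcases hstep _ V U hUV hVU hV hdet with hU | ⟨V', U', hUV', hVU', hV', hdet'⟩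
    · exact ⟨V, U, hUV, hVU, hV, hU⟩
    · exact ih V' U' hUV' hVU' hV' (by rw [hdet']; push_cast; ring_nf)

/-- Over a local ring, an idempotent matrix of polynomials that splits over the Laurent
polynomials splits over the polynomials. -/
theorem exists_factorization_of_isLocalRing
    {V : Matrix ι κ A[T;T⁻¹]} {U : Matrix κ ι A[T;T⁻¹]} {E : Matrix κ κ A[X]}
    (hUV : U * V = E.map toLaurent) (hVU : V * U = 1) :
    ∃ (P : Matrix κ ι A[X]) (Q : Matrix ι κ A[X]), P * Q = E ∧ Q * P = 1 := by
  have hI : maximalIdeal A ≤ Ideal.jacobson ⊥ := maximalIdeal_le_jacobson _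
  obtain ⟨N, hN⟩ := exists_forall_coeff_eq_zero_of_lt V
  obtain ⟨K, hK⟩ := exists_forall_coeff_eq_zero_of_lt U
  have hpoly : ∀ a i, ∃ f : A[X], toLaurent f = U a i * T K := fun a i =>
    exists_toLaurent_eq fun n hn => by
      rw [coeff_mul_T]
      exact hK a i _ (by omega)
  choose C' hC' using hpoly
  have hC : (Matrix.of C').map toLaurent = (T (K : ℤ) : A[T;T⁻¹]) • U := by
    ext1 a i
    simp [hC']
  obtain ⟨V', U', hUV', hVU', hV', hU'⟩ := exists_polynomialMod_of_det_eq E (Matrix.of C')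
    (Fintype.card ι * (N + K)) ((T (N : ℤ) : A[T;T⁻¹]) • V) ((T (-(N : ℤ)) : A[T;T⁻¹]) • U)
    (by rw [Matrix.smul_mul, Matrix.mul_smul, smul_smul, ← T_add]; simpa using hUV)
    (by rw [Matrix.smul_mul, Matrix.mul_smul, smul_smul, ← T_add]; simpa using hVU)
    (fun i a n hn => by
      rw [Matrix.smul_apply, smul_eq_mul, T_mul, coeff_mul_T, hN i a _ (by omega)]
      exact zero_mem _)
    (by
      rw [hC, Matrix.smul_mul, Matrix.mul_smul, smul_smul, hVU, ← T_add, Matrix.det_smul,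
        Matrix.det_one, mul_one, T_pow]
      push_cast
      rfl)
  refine exists_factorization_of_isCompl hUV' hVU' ⟨disjoint_iff.mpr ?_, codisjoint_iff.mpr ?_⟩
  · refine (Submodule.eq_bot_iff _).mpr fun x hx => ?_
    refine eq_zero_of_mem_columnSpan_of_mem_negativePart hUV' ?_ hx.1 hx.2
    refine columnSpan_sup_negativePart hI (U := V'.transpose) ?_ fun a i => hV' i a
    rw [← Matrix.transpose_mul, hVU', Matrix.transpose_one]
  · exact columnSpan_sup_negativePart hI hVU' hU'

end Local

end LaurentPolynomial

namespace Matrix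

section IdempotentEquiv

variable {R S l m n : Type*} [CommRing R] [CommRing S] [Fintype l] [Fintype m] [Fintype n]

/-- Murray-von Neumann equivalence of square matrices. Idempotent matrices are equivalent in
this sense precisely when their images are isomorphic. -/
def IdempotentEquiv (E : Matrix m m R) (F : Matrix n n R) : Prop :=
  ∃ (P : Matrix m n R) (Q : Matrix n m R), P * Q = E ∧ Q * P = F

theorem IdempotentEquiv.trans {E : Matrix l l R} {F : Matrix m m R} {G : Matrix n n R}
    (hE : E * E = E) (hG : G * G = G) (hEF : IdempotentEquiv E F) (hFG : IdempotentEquiv F G) :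
    IdempotentEquiv E G := by
  obtain ⟨P, Q, rfl, rfl⟩ := hEF
  obtain ⟨P', Q', hF, rfl⟩ := hFG
  refine ⟨P * P', Q' * Q, ?_, ?_⟩
  · rw [Matrix.mul_assoc, ← Matrix.mul_assoc P', hF, ← Matrix.mul_assoc, ← hE]
    simp only [Matrix.mul_assoc]
  · rw [Matrix.mul_assoc, ← Matrix.mul_assoc Q, ← hF, ← Matrix.mul_assoc, ← hG]
    simp only [Matrix.mul_assoc]

theorem IdempotentEquiv.map {E : Matrix m m R} {F : Matrix n n R} (h : IdempotentEquiv E F)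
    (f : R →+* S) : IdempotentEquiv (E.map f) (F.map f) := by
  obtain ⟨P, Q, rfl, rfl⟩ := h
  exact ⟨P.map f, Q.map f, Matrix.map_mul.symm, Matrix.map_mul.symm⟩

end IdempotentEquiv

end Matrix

namespace Polynomial

section Localization

variable {R S : Type*} [CommRing R] [CommRing S]

/-- The substitution `X ↦ s * X`. -/
noncomputable def dilate (s : R) : R[X] →+* R[X] := compRingHom (C s * X)

theorem dilate_eq (s : R) (p : R[X]) :
    dilate s p = C (p.coeff 0) + C s * X * dilate s p.divX := by
  conv_lhs => rw [← p.divX_mul_X_add, map_add, map_mul]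
  simp [dilate]
  ring

theorem dilate_dilate (s s' : R) (p : R[X]) : dilate s' (dilate s p) = dilate (s * s') p := by
  simp [dilate, comp_assoc, mul_assoc]

theorem coeff_zero_dilate (s : R) (p : R[X]) : (dilate s p).coeff 0 = p.coeff 0 := by
  rw [dilate_eq]
  simp [mul_assoc]

theorem map_dilate (f : R →+* S) (s : R) (p : R[X]) :
    (dilate s p).map f = dilate (f s) (p.map f) := by
  simp [dilate, Polynomial.map_comp]

variable [Algebra R S] (M : Submonoid R) [IsLocalization M S]

attribute [local instance] Polynomial.algebra Polynomial.isLocalization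

theorem exists_map_eq_dilate {τ : Type*} [Finite τ] (p : τ → S[X]) (p₀ : τ → R)
    (hp : ∀ i, (p i).coeff 0 = algebraMap R S (p₀ i)) :
    ∃ s ∈ M, ∃ q : τ → R[X], (∀ i, (q i).coeff 0 = p₀ i) ∧
      ∀ i, (q i).map (algebraMap R S) = dilate (algebraMap R S s) (p i) := by
  obtain ⟨⟨_, s, hs, rfl⟩, h⟩ :=
    IsLocalization.exist_integer_multiples_of_finite (M.map C) fun i => (p i).divX
  choose r hr using h
  have hr' : ∀ i, (r i).map (algebraMap R S) = C (algebraMap R S s) * (p i).divX := by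
    intro i
    have := hr i
    rw [Algebra.smul_def] at this
    simpa using this
  refine ⟨s, hs, fun i => C (p₀ i) + X * dilate s (r i), fun i => by simp, fun i => ?_⟩
  rw [Polynomial.map_add, Polynomial.map_mul, map_C, map_X, map_dilate, hr', map_mul,
    dilate_eq (algebraMap R S s) (p i), hp]
  simp [dilate]
  ring

theorem exists_dilate_eq_zero {τ : Type*} [Finite τ] (p : τ → R[X])
    (hp : ∀ i, (p i).coeff 0 = 0) (hpS : ∀ i, (p i).map (algebraMap R S) = 0) :
    ∃ s ∈ M, ∀ i, dilate s (p i) = 0 := by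
  classical
  cases nonempty_fintype τ
  have h : ∀ i, ∃ s ∈ M, C s * (p i).divX = 0 := by
    intro i
    have : algebraMap R[X] S[X] (p i).divX = 0 := by
      ext n
      have := congrArg (fun q => q.coeff (n + 1)) (hpS i)
      simpa [coeff_divX] using this
    obtain ⟨⟨_, s, hs, rfl⟩, h⟩ := (IsLocalization.map_eq_zero_iff (M.map C) S[X] _).mp this
    exact ⟨s, hs, h⟩
  choose s hs hsp using h
  refine ⟨∏ i, s i, prod_mem fun i _ => hs i, fun i => ?_⟩
  obtain ⟨t, ht⟩ := Finset.dvd_prod_of_mem s (Finset.mem_univ i)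
  have h0 : C (∏ i, s i) * (p i).divX = 0 := by
    rw [ht, C_mul, mul_right_comm, hsp, zero_mul]
  have h1 := congrArg (dilate (∏ i, s i)) h0
  have h2 : dilate (∏ i, s i) (C (∏ i, s i)) = C (∏ i, s i) := by simp [dilate]
  rw [map_mul, h2, map_zero] at h1
  rw [dilate_eq, hp, C_0, zero_add, mul_right_comm, h1, zero_mul]

theorem exists_idempotentEquiv_dilate {κ : Type*} [Fintype κ] {E₁ E₂ : Matrix κ κ R[X]}
    {E₀ : Matrix κ κ R} (hE₀ : E₀ * E₀ = E₀) (h₁ : E₁.map constantCoeff = E₀)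
    (h₂ : E₂.map constantCoeff = E₀) {P Q : Matrix κ κ S[X]}
    (hP : P.map constantCoeff = E₀.map (algebraMap R S))
    (hQ : Q.map constantCoeff = E₀.map (algebraMap R S))
    (hPQ : P * Q = E₁.map (mapRingHom (algebraMap R S)))
    (hQP : Q * P = E₂.map (mapRingHom (algebraMap R S))) :
    ∃ s ∈ M, (E₁.map (dilate s)).IdempotentEquiv (E₂.map (dilate s)) := by
  obtain ⟨s, hs, q, hq₀, hq⟩ := exists_map_eq_dilate (S := S) M
    (fun x : Bool × κ × κ => (bif x.1 then P else Q) x.2.1 x.2.2) (fun x => E₀ x.2.1 x.2.2) (by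
      rintro ⟨_ | _, a, b⟩
      · exact congrFun (congrFun hQ a) b
      · exact congrFun (congrFun hP a) b)
  let P' : Matrix κ κ R[X] := .of fun a b => q (true, a, b)
  let Q' : Matrix κ κ R[X] := .of fun a b => q (false, a, b)
  have hP'₀ : P'.map constantCoeff = E₀ := by
    ext a b
    exact hq₀ (true, a, b)
  have hQ'₀ : Q'.map constantCoeff = E₀ := by
    ext a b
    exact hq₀ (false, a, b)
  have hP' : P'.map (mapRingHom (algebraMap R S)) = P.map (dilate (algebraMap R S s)) := by
    ext1 a b
    exact hq (true, a, b)
  have hQ' : Q'.map (mapRingHom (algebraMap R S)) = Q.map (dilate (algebraMap R S s)) := by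
    ext1 a b
    exact hq (false, a, b)
  have hdil : ∀ F : Matrix κ κ R[X], (F.map (dilate s)).map (mapRingHom (algebraMap R S)) =
      (F.map (mapRingHom (algebraMap R S))).map (dilate (algebraMap R S s)) := fun F => by
    ext1 a b
    exact map_dilate _ _ _
  have hdil₀ : ∀ F : Matrix κ κ R[X], (F.map (dilate s)).map constantCoeff =
      F.map constantCoeff := fun F => by
    ext1 a b
    exact coeff_zero_dilate _ _
  let D₁ := P' * Q' - E₁.map (dilate s)
  let D₂ := Q' * P' - E₂.map (dilate s)
  have hD₁ : D₁.map (mapRingHom (algebraMap R S)) = 0 := by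
    rw [Matrix.map_sub _ (map_sub _), Matrix.map_mul, hP', hQ', hdil, ← Matrix.map_mul, hPQ,
      sub_self]
  have hD₂ : D₂.map (mapRingHom (algebraMap R S)) = 0 := by
    rw [Matrix.map_sub _ (map_sub _), Matrix.map_mul, hP', hQ', hdil, ← Matrix.map_mul, hQP,
      sub_self]
  have hD₁₀ : D₁.map constantCoeff = 0 := by
    rw [Matrix.map_sub _ (map_sub _), Matrix.map_mul, hP'₀, hQ'₀, hdil₀, h₁, hE₀, sub_self]
  have hD₂₀ : D₂.map constantCoeff = 0 := by
    rw [Matrix.map_sub _ (map_sub _), Matrix.map_mul, hP'₀, hQ'₀, hdil₀, h₂, hE₀, sub_self]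
  obtain ⟨s', hs', h⟩ := exists_dilate_eq_zero (S := S) M
    (fun x : Bool × κ × κ => (bif x.1 then D₁ else D₂) x.2.1 x.2.2) (by
      rintro ⟨_ | _, a, b⟩
      · exact congrFun (congrFun hD₂₀ a) b
      · exact congrFun (congrFun hD₁₀ a) b) (by
      rintro ⟨_ | _, a, b⟩
      · exact congrFun (congrFun hD₂ a) b
      · exact congrFun (congrFun hD₁ a) b)
  have hcomp : ∀ F : Matrix κ κ R[X],
      F.map (dilate (s * s')) = (F.map (dilate s)).map (dilate s') := fun F => by
    ext1 a b
    exact (dilate_dilate _ _ _).symm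
  refine ⟨s * s', M.mul_mem hs hs', P'.map (dilate s'), Q'.map (dilate s'), ?_, ?_⟩
  · rw [← Matrix.map_mul, hcomp, ← sub_eq_zero, ← Matrix.map_sub _ (map_sub _)]
    ext1 a b
    exact h (true, a, b)
  · rw [← Matrix.map_mul, hcomp, ← sub_eq_zero, ← Matrix.map_sub _ (map_sub _)]
    ext1 a b
    exact h (false, a, b)

end Localization

end Polynomial

namespace Polynomial

section Shift

variable {R S : Type*} [CommRing R] [CommRing S]

/-- The substitution of `t + X` for the variable `t` of `R[t]`. -/
noncomputable def shift : R[X] →+* R[X][X] := eval₂RingHom (C.comp C) (C X + X)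

theorem shift_X : shift (X : R[X]) = C X + X := by
  simp [shift]

theorem shift_C (r : R) : shift (C r) = C (C r) := by
  simp [shift]

theorem constantCoeff_comp_shift : constantCoeff.comp shift = RingHom.id R[X] :=
  ringHom_ext (by simp [shift_C]) (by simp [shift_X])

theorem mapRingHom_comp_shift (f : R →+* S) :
    (mapRingHom (mapRingHom f)).comp shift = shift.comp (mapRingHom f) :=
  ringHom_ext (by simp [shift_C]) (by simp [shift_X])

end Shift

section Patching

variable {A : Type*} [CommRing A] {κ : Type*} [Fintype κ]

attribute [local instance] Polynomial.algebra Polynomial.isLocalization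

theorem exists_idempotentEquiv_dilate_shift (M : Submonoid A) (B : Type*) [CommRing B]
    [Algebra A B] [IsLocalization M B] {ι : Type*} [Fintype ι] [DecidableEq ι]
    {E : Matrix κ κ A[X]} (hE : E * E = E)
    (h : (E.map (mapRingHom (algebraMap A B))).IdempotentEquiv (1 : Matrix ι ι B[X])) :
    ∃ s ∈ M, ((E.map shift).map (dilate (C s))).IdempotentEquiv
      ((E.map C).map (dilate (C s))) := by
  obtain ⟨P, Q, hPQ, hQP⟩ := h
  have hid : ∀ F : Matrix κ κ A[X], (F.map shift).map constantCoeff = F := fun F => by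
    ext1 a b
    exact DFunLike.congr_fun constantCoeff_comp_shift _
  have hP : (P.map shift).map constantCoeff = P := by
    ext1 a b
    exact DFunLike.congr_fun constantCoeff_comp_shift _
  have hQ : (Q.map shift).map constantCoeff = Q := by
    ext1 a b
    exact DFunLike.congr_fun constantCoeff_comp_shift _
  have hP' : (P.map C).map constantCoeff = P := by
    ext1 a b
    simp
  have hQ' : (Q.map C).map constantCoeff = Q := by
    ext1 a b
    simp
  obtain ⟨_, ⟨s, hs, rfl⟩, h⟩ := exists_idempotentEquiv_dilate (S := B[X]) (M.map C)
    (E₁ := E.map shift) (E₂ := E.map C) (P := P.map shift * Q.map C)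
    (Q := P.map C * Q.map shift) hE (hid E) (by ext1 a b; simp)
    (by rw [Matrix.map_mul, hP, hQ', hPQ]; rfl)
    (by rw [Matrix.map_mul, hP', hQ, hPQ]; rfl)
    (by
      rw [Matrix.mul_assoc, ← Matrix.mul_assoc (Q.map C), ← Matrix.map_mul, hQP,
        Matrix.map_one _ (map_zero _) (map_one _), Matrix.one_mul, ← Matrix.map_mul, hPQ]
      ext1 a b
      exact (DFunLike.congr_fun (mapRingHom_comp_shift _) _).symm)
    (by
      rw [Matrix.mul_assoc, ← Matrix.mul_assoc (Q.map shift), ← Matrix.map_mul, hQP,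
        Matrix.map_one _ (map_zero _) (map_one _), Matrix.one_mul, ← Matrix.map_mul, hPQ]
      ext1 a b
      simp)
  exact ⟨s, hs, h⟩

end Patching

section Patching

universe u

variable {A : Type u} [CommRing A] {κ : Type*} [Fintype κ]

/-- The ideal of those `b` for which `E` is insensitive, up to equivalence, to translations
of the variable by multiples of `b`. -/
def patchingIdeal {E : Matrix κ κ A[X]} (hE : E * E = E) : Ideal A where
  carrier := {b | ∀ (B : Type u) [CommRing B] [Algebra A B] (x y : B),
    (E.map (aeval (x + b • y))).IdempotentEquiv (E.map (aeval x))}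
  zero_mem' B _ _ x y := by
    refine ⟨E.map (aeval x), E.map (aeval x), ?_, ?_⟩ <;>
      simp only [zero_smul, add_zero, ← Matrix.map_mul, hE]
  add_mem' {a b} ha hb B _ _ x y := by
    rw [add_smul, ← add_assoc]
    exact (hb B (x + a • y) y).trans (by rw [← Matrix.map_mul, hE])
      (by rw [← Matrix.map_mul, hE]) (ha B x y)
  smul_mem' c b hb B _ _ x y := by
    rw [smul_assoc, smul_comm]
    exact hb B x (c • y)

theorem mem_patchingIdeal {E : Matrix κ κ A[X]} (hE : E * E = E) {s : A}
    (h : ((E.map shift).map (dilate (C s))).IdempotentEquiv ((E.map C).map (dilate (C s)))) :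
    s ∈ patchingIdeal hE := by
  intro B _ _ x y
  let φ : A[X][X] →+* B := eval₂RingHom (aeval x).toRingHom y
  have h₁ : (φ.comp (dilate (C s))).comp shift = (aeval (x + s • y)).toRingHom :=
    ringHom_ext (by simp [φ, shift_C, dilate]) (by simp [φ, shift_X, dilate, Algebra.smul_def])
  have h₂ : (φ.comp (dilate (C s))).comp C = (aeval x).toRingHom :=
    ringHom_ext (by simp [φ, dilate]) (by simp [φ, dilate])
  convert h.map φ using 1
  · ext1 a b
    exact (DFunLike.congr_fun h₁ _).symm
  · ext1 a b
    exact (DFunLike.congr_fun h₂ _).symm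

theorem idempotentEquiv_map_C_constantCoeff {E : Matrix κ κ A[X]} (hE : E * E = E)
    (h : ∀ (m : Ideal A) [m.IsMaximal], ∃ s ∉ m,
      ((E.map shift).map (dilate (C s))).IdempotentEquiv ((E.map C).map (dilate (C s)))) :
    E.IdempotentEquiv ((E.map constantCoeff).map C) := by
  have htop : patchingIdeal hE = ⊤ := by
    by_contra hne
    obtain ⟨m, hm, hle⟩ := Ideal.exists_le_maximal _ hne
    obtain ⟨s, hs, hsE⟩ := h m
    exact hs (hle (mem_patchingIdeal hE hsE))
  have h1 : (1 : A) ∈ patchingIdeal hE := htop ▸ Submodule.mem_top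
  convert h1 A[X] 0 X using 1
  · ext1 a b
    simp
  · ext1 a b
    simp [aeval_def, eval₂_at_zero]

end Patching

end Polynomial

namespace LaurentPolynomial

theorem mapRingHom_comp_toLaurent {R S : Type*} [CommRing R] [CommRing S] (f : R →+* S) :
    (AddMonoidAlgebra.mapRingHom ℤ f).comp toLaurent =
      (toLaurent : S[X] →+* S[T;T⁻¹]).comp (mapRingHom f) :=
  Polynomial.ringHom_ext
    (fun r => by
      simp only [RingHom.comp_apply, coe_mapRingHom, map_C, toLaurent_C]
      exact AddMonoidAlgebra.mapRingHom_single ..)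
    (by
      simp only [RingHom.comp_apply, coe_mapRingHom, map_X, toLaurent_X]
      exact (AddMonoidAlgebra.mapRingHom_single ..).trans (by rw [map_one]; rfl))

theorem idempotentEquiv_map_C_constantCoeff {A : Type*} [CommRing A] {κ ι : Type*} [Fintype κ]
    [Fintype ι] [DecidableEq ι] {E : Matrix κ κ A[X]} (hE : E * E = E)
    (h : (E.map toLaurent).IdempotentEquiv (1 : Matrix ι ι A[T;T⁻¹])) :
    E.IdempotentEquiv ((E.map constantCoeff).map Polynomial.C) := by
  refine Polynomial.idempotentEquiv_map_C_constantCoeff hE fun m _ => ?_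
  let f := algebraMap A (Localization.AtPrime m)
  obtain ⟨U, V, hUV, hVU⟩ := h.map (AddMonoidAlgebra.mapRingHom ℤ f)
  rw [Matrix.map_one _ (map_zero _) (map_one _)] at hVU
  have hE' : (E.map toLaurent).map (AddMonoidAlgebra.mapRingHom ℤ f) =
      (E.map (mapRingHom f)).map toLaurent := by
    ext1 a b
    exact DFunLike.congr_fun (mapRingHom_comp_toLaurent f) _
  obtain ⟨P, Q, hPQ, hQP⟩ := exists_factorization_of_isLocalRing (hUV.trans hE') hVU
  exact exists_idempotentEquiv_dilate_shift m.primeCompl (Localization.AtPrime m) hE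
    ⟨P, Q, hPQ, hQP⟩

end LaurentPolynomial

namespace Module

variable {R M : Type*} [CommRing R] [AddCommGroup M] [Module R M]

theorem exists_finite_retract [Module.Finite R M] [Module.Projective R M] :
    ∃ (n : ℕ) (p : (Fin n → R) →ₗ[R] M) (s : M →ₗ[R] (Fin n → R)), p ∘ₗ s = LinearMap.id := by
  obtain ⟨n, p, hp⟩ := Module.Finite.exists_fin' R M
  obtain ⟨s, hs⟩ := Module.projective_lifting_property p LinearMap.id hp
  exact ⟨n, p, s, hs⟩

variable {κ : Type*} [Fintype κ] [DecidableEq κ] {p : (κ → R) →ₗ[R] M} {s : M →ₗ[R] (κ → R)}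

theorem exists_idempotentEquiv_one_of_free_baseChange [Module.Finite R M]
    (hps : p ∘ₗ s = LinearMap.id) (B : Type*) [CommRing B] [Algebra R B]
    [Module.Free B (B ⊗[R] M)] :
    ∃ n, ((LinearMap.toMatrix' (s ∘ₗ p)).map (algebraMap R B)).IdempotentEquiv
      (1 : Matrix (Fin n) (Fin n) B) := by
  let b := (Module.Free.chooseBasis B (B ⊗[R] M)).reindex (Fintype.equivFin _)
  let c := Algebra.TensorProduct.basis B (Pi.basisFun R κ)
  refine ⟨_, LinearMap.toMatrix b c (s.baseChange B), LinearMap.toMatrix c b (p.baseChange B),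
    ?_, ?_⟩
  · rw [← LinearMap.toMatrix_comp, ← LinearMap.baseChange_comp, LinearMap.toMatrix_baseChange,
      LinearMap.toMatrix_eq_toMatrix']
  · rw [← LinearMap.toMatrix_comp, ← LinearMap.baseChange_comp, hps, LinearMap.baseChange_id,
      LinearMap.toMatrix_id]

theorem free_of_idempotentEquiv_one (hps : p ∘ₗ s = LinearMap.id) {ι : Type*} [Fintype ι]
    [DecidableEq ι]
    (h : (LinearMap.toMatrix' (s ∘ₗ p)).IdempotentEquiv (1 : Matrix ι ι R)) :
    Module.Free R M := by
  obtain ⟨P, Q, hPQ, hQP⟩ := h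
  have hPQ' : P.toLin' ∘ₗ Q.toLin' = s ∘ₗ p := by
    rw [← Matrix.toLin'_mul, hPQ, Matrix.toLin'_toMatrix']
  have hQP' : Q.toLin' ∘ₗ P.toLin' = LinearMap.id := by
    rw [← Matrix.toLin'_mul, hQP, Matrix.toLin'_one]
  have hps' : ∀ x, p (s x) = x := fun x => DFunLike.congr_fun hps x
  refine .of_equiv (.ofLinearMap (p ∘ₗ P.toLin') (Q.toLin' ∘ₗ s) ?_ ?_ : (ι → R) ≃ₗ[R] M)
  · ext x
    have := DFunLike.congr_fun hPQ' (s x)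
    simp only [LinearMap.comp_apply, LinearMap.id_apply] at this ⊢
    rw [this, hps', hps']
  · refine LinearMap.ext fun x => ?_
    have := DFunLike.congr_fun hPQ' (P.toLin' x)
    have h1 : ∀ x, Q.toLin' (P.toLin' x) = x := fun x => DFunLike.congr_fun hQP' x
    simp only [LinearMap.comp_apply, LinearMap.id_apply] at this ⊢
    rw [← this, h1, h1]

end Module

/-- A finitely generated projective `A[t]`-module that becomes free over the Laurent
polynomial ring `A[t, t⁻¹]` and over the power series ring `A⟦t⟧` is free. -/
theorem free_of_free_laurentPolynomial_and_powerSeries (A : Type*) [CommRing A]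
    (M : Type*) [AddCommGroup M] [Module (Polynomial A) M]
    [Module.Finite (Polynomial A) M] [Module.Projective (Polynomial A) M]
    (h1 : Module.Free (LaurentPolynomial A) (LaurentPolynomial A ⊗[Polynomial A] M))
    (h2 : Module.Free (PowerSeries A) (PowerSeries A ⊗[Polynomial A] M)) :
    Module.Free (Polynomial A) M := by
  obtain ⟨n, p, s, hps⟩ := Module.exists_finite_retract (R := A[X]) (M := M)
  have hE : LinearMap.toMatrix' (s ∘ₗ p) * LinearMap.toMatrix' (s ∘ₗ p) =
      LinearMap.toMatrix' (s ∘ₗ p) := by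
    rw [← LinearMap.toMatrix'_comp, LinearMap.comp_assoc, ← LinearMap.comp_assoc p s p, hps,
      LinearMap.id_comp]
  obtain ⟨k, hk⟩ := Module.exists_idempotentEquiv_one_of_free_baseChange hps A[T;T⁻¹]
  obtain ⟨l, hl⟩ := Module.exists_idempotentEquiv_one_of_free_baseChange hps (PowerSeries A)
  have hl' := (hl.map PowerSeries.constantCoeff).map (C : A →+* A[X])
  rw [Matrix.map_one _ (map_zero _) (map_one _), Matrix.map_one _ (map_zero _) (map_one _)] at hl'
  refine Module.free_of_idempotentEquiv_one hps (ι := Fin l) <|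
    (LaurentPolynomial.idempotentEquiv_map_C_constantCoeff hE hk).trans hE (one_mul 1) ?_
  convert hl' using 1
  ext1 a b
  simp [PowerSeries.algebraMap_apply']
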